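/- Let U ⊆ (0, 2π) be an open set with π ∉ U, and let ψ : ℝ → ℝ be a C^∞ function with compact support contained in U and with ∫_0^{2π} ψ(t) dt = 0. Define u_0(x) := (1/2) ∫_0^x ( ψ(t) + ψ(2π − t) ) dt for x ∈ [0, π] and u_1(t) := (1/2) ( ψ(t) − ψ(2π − t) ) for t ∈ (0, π). Then u_0(0) = u_0(π) = 0, and the Fourier series Σ_{j≥1} ( j·û_0(j)·cos(j t) + û_1(j)·sin(j t) ), where û_h(j) := (2/π) ∫_0^π u_h(x) sin(j x) dx for h = 0, 1, converges in L²(0, 2π) to ψ. -/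

import Mathlib

open MeasureTheory Set Real Filter Topology

noncomputable section

/-- u₀(x) = (1/2) ∫₀ˣ (ψ(t) + ψ(2π − t)) dt. -/
def uZero (ψ : ℝ → ℝ) (x : ℝ) : ℝ :=
  (1 / 2) * ∫ t in (0 : ℝ)..x, (ψ t + ψ (2 * Real.pi - t))

/-- u₁(t) = (1/2) (ψ(t) − ψ(2π − t)). -/
def uOne (ψ : ℝ → ℝ) (t : ℝ) : ℝ :=
  (1 / 2) * (ψ t - ψ (2 * Real.pi - t))

/-- The j-th Fourier sine coefficient û(j) = (2/π) ∫₀^π u(x) sin(jx) dx. -/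
def sineCoeff (u : ℝ → ℝ) (j : ℕ) : ℝ :=
  (2 / Real.pi) * ∫ x in (0 : ℝ)..Real.pi, u x * Real.sin ((j : ℝ) * x)


lemma fold_int (h : ℝ → ℝ) (hh : Continuous h) :
    ∫ t in (0:ℝ)..(2 * Real.pi), h t
      = ∫ t in (0:ℝ)..Real.pi, (h t + h (2 * Real.pi - t)) := by
  rw [intervalIntegral.integral_add (hh.intervalIntegrable _ _)
    ((by fun_prop : Continuous (fun t => h (2 * Real.pi - t))).intervalIntegrable _ _)]
  rw [intervalIntegral.integral_comp_sub_left (fun x => h x)]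
  rw [sub_zero, show 2 * Real.pi - Real.pi = Real.pi by ring]
  rw [intervalIntegral.integral_add_adjacent_intervals (hh.intervalIntegrable _ _)
    (hh.intervalIntegrable _ _)]

lemma cos_refl (j : ℕ) (t : ℝ) :
    Real.cos ((j:ℝ) * (2 * Real.pi - t)) = Real.cos ((j:ℝ) * t) := by
  rw [show (j:ℝ) * (2 * Real.pi - t) = (j:ℝ) * (2 * Real.pi) - j * t by ring]
  exact Real.cos_nat_mul_two_pi_sub _ _

lemma sin_refl (j : ℕ) (t : ℝ) :
    Real.sin ((j:ℝ) * (2 * Real.pi - t)) = - Real.sin ((j:ℝ) * t) := by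
  rw [show (j:ℝ) * (2 * Real.pi - t) = (j:ℝ) * (2 * Real.pi) - j * t by ring]
  exact Real.sin_nat_mul_two_pi_sub _ _

lemma uOne_coeff (ψ : ℝ → ℝ) (hc : Continuous ψ) (j : ℕ) :
    sineCoeff (uOne ψ) j
      = (1 / Real.pi) * ∫ t in (0:ℝ)..(2 * Real.pi), ψ t * Real.sin ((j:ℝ) * t) := by
  rw [fold_int (fun t => ψ t * Real.sin ((j:ℝ) * t)) (by fun_prop)]
  unfold sineCoeff uOne
  simp_rw [sin_refl]
  rw [show (fun x => 1 / 2 * (ψ x - ψ (2 * Real.pi - x)) * Real.sin ((j:ℝ) * x))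
    = fun x => 1 / 2 * (ψ x * Real.sin ((j:ℝ) * x) + ψ (2 * Real.pi - x) * -Real.sin ((j:ℝ) * x))
    by ext x; ring]
  rw [intervalIntegral.integral_const_mul]
  ring

lemma uZero_pi (ψ : ℝ → ℝ) (hc : Continuous ψ)
    (hψint : ∫ t in (0 : ℝ)..(2 * Real.pi), ψ t = 0) : uZero ψ Real.pi = 0 := by
  unfold uZero
  rw [← fold_int ψ hc, hψint, mul_zero]

lemma uZero_coeff (ψ : ℝ → ℝ) (hc : Continuous ψ)
    (hψint : ∫ t in (0 : ℝ)..(2 * Real.pi), ψ t = 0) (j : ℕ) :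
    (j:ℝ) * sineCoeff (uZero ψ) j
      = (1 / Real.pi) * ∫ t in (0:ℝ)..(2 * Real.pi), ψ t * Real.cos ((j:ℝ) * t) := by
  have hc2 : Continuous (fun t => ψ t + ψ (2 * Real.pi - t)) := by fun_prop
  have h1 := intervalIntegral.integral_mul_deriv_eq_deriv_mul (a := 0) (b := Real.pi)
    (u := uZero ψ) (u' := fun t => (1 / 2) * (ψ t + ψ (2 * Real.pi - t)))
    (v := fun x => - Real.cos ((j:ℝ) * x)) (v' := fun x => (j:ℝ) * Real.sin ((j:ℝ) * x))
    (fun x _ => by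
      unfold uZero
      exact (intervalIntegral.integral_hasDerivAt_right (hc2.intervalIntegrable _ _)
        (hc2.stronglyMeasurableAtFilter _ _) hc2.continuousAt).const_mul _)
    (fun x _ => by
      have := (((hasDerivAt_id x).const_mul (j:ℝ)).cos).neg
      convert! this using 1
      simp; ring)
    ((by fun_prop : Continuous (fun t => (1 / 2) * (ψ t + ψ (2 * Real.pi - t)))).intervalIntegrable _ _)
    ((by fun_prop : Continuous (fun x => (j:ℝ) * Real.sin ((j:ℝ) * x))).intervalIntegrable _ _)
  rw [uZero_pi ψ hc hψint, show uZero ψ 0 = 0 by simp [uZero]] at h1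
  rw [fold_int (fun t => ψ t * Real.cos ((j:ℝ) * t)) (by fun_prop)]
  simp_rw [cos_refl]
  unfold sineCoeff
  rw [show (fun x => uZero ψ x * ((j:ℝ) * Real.sin ((j:ℝ) * x)))
    = fun x => (j:ℝ) * (uZero ψ x * Real.sin ((j:ℝ) * x)) by ext x; ring,
    intervalIntegral.integral_const_mul,
    show (fun x => 1 / 2 * (ψ x + ψ (2 * Real.pi - x)) * -Real.cos ((j:ℝ) * x))
    = fun x => (-1 / 2) * (ψ x * Real.cos ((j:ℝ) * x) + ψ (2 * Real.pi - x) * Real.cos ((j:ℝ) * x))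
    by ext x; ring, intervalIntegral.integral_const_mul] at h1
  linear_combination (2 / Real.pi) * h1

instance fact_two_pi : Fact (0 < 2 * Real.pi) := ⟨Real.two_pi_pos⟩

lemma four_apply (n : ℤ) (x : ℝ) :
    (fourier n (x : AddCircle (2 * Real.pi)) : ℂ)
      = (Real.cos (n * x) : ℂ) + (Real.sin (n * x) : ℂ) * Complex.I := by
  rw [fourier_coe_apply, Complex.ofReal_cos, Complex.ofReal_sin, ← Complex.exp_mul_I]
  congr 1
  have : (Real.pi : ℂ) ≠ 0 := by exact_mod_cast Real.pi_ne_zero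
  push_cast
  field_simp

lemma coeff_formula (ψ : ℝ → ℝ) (hc : Continuous ψ) (g : AddCircle (2 * Real.pi) → ℂ)
    (hg : ∀ x ∈ Icc 0 (2 * Real.pi), g (x : ℝ) = (ψ x : ℂ)) (n : ℤ) :
    fourierCoeff g n = (((1 / (2 * Real.pi)) *
        ∫ t in (0:ℝ)..(2 * Real.pi), ψ t * Real.cos (n * t) : ℝ) : ℂ)
      - (((1 / (2 * Real.pi)) *
        ∫ t in (0:ℝ)..(2 * Real.pi), ψ t * Real.sin (n * t) : ℝ) : ℂ) * Complex.I := by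
  rw [fourierCoeff_eq_intervalIntegral g n 0, zero_add]
  have : ∫ x in (0:ℝ)..(2 * Real.pi), (fourier (-n) (x : AddCircle (2 * Real.pi)) : ℂ) • g x
      = ∫ x in (0:ℝ)..(2 * Real.pi), (((ψ x * Real.cos (n * x) : ℝ) : ℂ)
        - ((ψ x * Real.sin (n * x) : ℝ) : ℂ) * Complex.I) := by
    apply intervalIntegral.integral_congr
    intro x hx
    rw [uIcc_of_le Real.two_pi_pos.le] at hx
    simp only [hg x hx, four_apply]
    push_cast
    simp only [neg_mul, Complex.cos_neg, Complex.sin_neg, smul_eq_mul]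
    ring
  rw [this, intervalIntegral.integral_sub
    ((by fun_prop : Continuous _).intervalIntegrable _ _)
    ((by fun_prop : Continuous _).intervalIntegrable _ _), intervalIntegral.integral_mul_const,
    intervalIntegral.integral_ofReal, intervalIntegral.integral_ofReal, Complex.real_smul]
  push_cast
  ring

lemma pair_formula (ψ : ℝ → ℝ) (hc : Continuous ψ) (g : AddCircle (2 * Real.pi) → ℂ)
    (hg : ∀ x ∈ Icc 0 (2 * Real.pi), g (x : ℝ) = (ψ x : ℂ))
    (hψint : ∫ t in (0 : ℝ)..(2 * Real.pi), ψ t = 0) (j : ℕ) (s : ℝ) :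
    fourierCoeff g (j:ℤ) * fourier (j:ℤ) (s : AddCircle (2 * Real.pi))
      + fourierCoeff g (-(j:ℤ)) * fourier (-(j:ℤ)) (s : AddCircle (2 * Real.pi))
    = (((j : ℝ) * sineCoeff (uZero ψ) j * Real.cos ((j : ℝ) * s) +
              sineCoeff (uOne ψ) j * Real.sin ((j : ℝ) * s) : ℝ) : ℂ) := by
  rw [uZero_coeff ψ hc hψint, uOne_coeff ψ hc, coeff_formula ψ hc g hg,
    coeff_formula ψ hc g hg, four_apply, four_apply]
  simp only [Int.cast_neg, Int.cast_natCast, neg_mul, Real.cos_neg, Real.sin_neg, mul_neg,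
    intervalIntegral.integral_neg]
  set A := ∫ t in (0:ℝ)..(2 * Real.pi), ψ t * Real.cos ((j:ℝ) * t)
  set B := ∫ t in (0:ℝ)..(2 * Real.pi), ψ t * Real.sin ((j:ℝ) * t)
  have : (Real.pi : ℂ) ≠ 0 := by exact_mod_cast Real.pi_ne_zero
  push_cast
  field_simp
  ring_nf
  simp only [Complex.I_sq]
  ring

lemma norm_sq_formula (F : C(AddCircle (2 * Real.pi), ℂ)) (f : ℝ → ℝ)
    (hF : ∀ x ∈ Icc 0 (2 * Real.pi), F (x : ℝ) = (f x : ℂ)) :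
    ∫ s in (0:ℝ)..(2 * Real.pi), f s ^ 2
      = 2 * Real.pi * ‖ContinuousMap.toLp (E := ℂ) 2 AddCircle.haarAddCircle ℂ F‖ ^ 2 := by
  have h1 := inner_self_eq_norm_sq_to_K (𝕜 := ℂ)
    (ContinuousMap.toLp (E := ℂ) 2 AddCircle.haarAddCircle ℂ F)
  rw [ContinuousMap.inner_toLp] at h1
  have h2 := fourierCoeff_eq_intervalIntegral
    (fun x : AddCircle (2 * Real.pi) => F x * (starRingEnd ℂ) (F x)) 0 0
  have h3 : fourierCoeff (fun x : AddCircle (2 * Real.pi) => F x * (starRingEnd ℂ) (F x)) 0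
      = ∫ x, F x * (starRingEnd ℂ) (F x) ∂AddCircle.haarAddCircle := by
    simp [fourierCoeff]
  have h4 : ∫ x in (0:ℝ)..(2 * Real.pi), (fourier (-0) (x : AddCircle (2 * Real.pi)) : ℂ) •
      (F x * (starRingEnd ℂ) (F x)) = ∫ x in (0:ℝ)..(2 * Real.pi), ((f x ^ 2 : ℝ) : ℂ) := by
    apply intervalIntegral.integral_congr
    intro x hx
    rw [uIcc_of_le Real.two_pi_pos.le] at hx
    simp [hF x hx, sq]
  rw [zero_add, h3, h1, h4, intervalIntegral.integral_ofReal, Complex.real_smul] at h2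
  have h5 : ‖ContinuousMap.toLp (E := ℂ) 2 AddCircle.haarAddCircle ℂ F‖ ^ 2
      = 1 / (2 * Real.pi) * ∫ s in (0:ℝ)..(2 * Real.pi), f s ^ 2 := by
    refine Complex.ofReal_injective (Eq.trans ?_ (h2.trans ?_))
    · push_cast
      rfl
    · push_cast
      rfl
  rw [h5]
  have := Real.pi_ne_zero
  field_simp

lemma sum_range_Icc (f : ℕ → ℝ) (h0 : f 0 = 0) (M : ℕ) :
    ∑ j ∈ Finset.range (M + 1), f j = ∑ j ∈ Finset.Icc 1 M, f j := by
  induction M with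
  | zero => simp [h0]
  | succ k ih => rw [Finset.sum_range_succ, ih, Finset.sum_Icc_succ_top (by omega)]

/-- Lemma 3.2: given an open set U ⊆ (0,2π) with π ∉ U and a smooth ψ compactly
supported in U with ∫₀^{2π} ψ = 0, the initial data u₀, u₁ defined above satisfy
u₀(0) = u₀(π) = 0 and the series Σ_{j≥1} (j·û₀(j)·cos(jt) + û₁(j)·sin(jt))
converges to ψ in L²(0,2π). -/
theorem stmt_2 (U : Set ℝ) (hUopen : IsOpen U) (hUsub : U ⊆ Set.Ioo 0 (2 * Real.pi))
    (hpi : Real.pi ∉ U)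
    (ψ : ℝ → ℝ) (hψ : ContDiff ℝ (⊤ : ℕ∞) ψ) (hψsupp : tsupport ψ ⊆ U)
    (hψint : ∫ t in (0 : ℝ)..(2 * Real.pi), ψ t = 0) :
    uZero ψ 0 = 0 ∧ uZero ψ Real.pi = 0 ∧
    Filter.Tendsto (fun M : ℕ =>
        ∫ s in (0 : ℝ)..(2 * Real.pi),
          ((∑ j ∈ Finset.Icc 1 M,
            ((j : ℝ) * sineCoeff (uZero ψ) j * Real.cos ((j : ℝ) * s) +
              sineCoeff (uOne ψ) j * Real.sin ((j : ℝ) * s))) - ψ s) ^ 2)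
      Filter.atTop (nhds 0) := by
  have hc : Continuous ψ := hψ.continuous
  have hz : ∀ x, x ∉ Set.Ioo 0 (2 * Real.pi) → ψ x = 0 := fun x hx =>
    image_eq_zero_of_notMem_tsupport (fun h => hx (hUsub (hψsupp h)))
  have hz0 : ψ 0 = 0 := hz 0 (by simp)
  have hz1 : ψ (2 * Real.pi) = 0 := hz _ (by simp)
  refine ⟨by simp [uZero], uZero_pi ψ hc hψint, ?_⟩
  let g : C(AddCircle (2 * Real.pi), ℂ) :=
    ⟨AddCircle.liftIco (2 * Real.pi) 0 (fun x => (ψ x : ℂ)),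
      AddCircle.liftIco_zero_continuous (by simp [hz0, hz1]) (by fun_prop)⟩
  have hg : ∀ x ∈ Icc 0 (2 * Real.pi), g (x : ℝ) = (ψ x : ℂ) := by
    intro x hx
    rcases eq_or_lt_of_le hx.2 with h | h
    · rw [h, AddCircle.coe_period, hz1, ← hz0, ← QuotientAddGroup.mk_zero]
      exact AddCircle.liftIco_zero_coe_apply (f := fun x => (ψ x : ℂ)) ⟨le_rfl, Real.two_pi_pos⟩
    · exact AddCircle.liftIco_zero_coe_apply (f := fun x => (ψ x : ℂ)) ⟨hx.1, h⟩
  have hs := hasSum_fourier_series_L2 (ContinuousMap.toLp (E := ℂ) 2 AddCircle.haarAddCircle ℂ g)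
  simp_rw [fourierCoeff_toLp] at hs
  have hs2 := hs.nat_add_neg
  have hc0 : fourierCoeff g 0 = 0 := by
    rw [coeff_formula ψ hc g hg]
    simp [hψint]
  rw [hc0, zero_smul, add_zero] at hs2
  have ht := (hs2.tendsto_sum_nat.comp (tendsto_add_atTop_nat 1)).sub_const
    (ContinuousMap.toLp (E := ℂ) 2 AddCircle.haarAddCircle ℂ g)
  rw [sub_self] at ht
  have ht2 := ((ht.norm.pow 2).const_mul (2 * Real.pi))
  simp only [norm_zero, ne_eq, OfNat.ofNat_ne_zero, not_false_eq_true, zero_pow, mul_zero] at ht2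
  refine ht2.congr fun M => ?_
  let F : C(AddCircle (2 * Real.pi), ℂ) := ∑ j ∈ Finset.range (M + 1),
    (fourierCoeff g (j:ℤ) • fourier (j:ℤ) + fourierCoeff g (-(j:ℤ)) • fourier (-(j:ℤ))) - g
  rw [norm_sq_formula F]
  · simp only [F, map_sub, map_sum, map_add, map_smul, Function.comp]
  · intro x hx
    rw [← sum_range_Icc _ (by simp)]
    simp only [F, ContinuousMap.sub_apply, ContinuousMap.sum_apply, ContinuousMap.add_apply,
      ContinuousMap.smul_apply, smul_eq_mul, hg x hx]
    rw [Complex.ofReal_sub, Complex.ofReal_sum]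
    congr 1
    exact Finset.sum_congr rfl fun j _ => pair_formula ψ hc g hg hψint j x
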